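/- The cubic surface defined by f(z₁,z₂,z₃,z₄) = z₁z₄² + z₂z₃² − z₃z₂² − z₄z₁² is nonsingular and contains exactly five twistor lines; the five twistor lines are the subspaces span{(0,0,0,1),(0,0,1,0)}, span{(0,1,0,0),(1,0,0,0)}, and span{(0,t,0,1),(t̄,0,1,0)} for t ranging over the three complex cube roots of unity. -/

import Mathlib

noncomputable section

open MvPolynomial

/-- The standard twistor structure `j : ℂ⁴ → ℂ⁴`,
`j(z₁,z₂,z₃,z₄) = (−z̄₂, z̄₁, −z̄₄, z̄₃)`. -/
def J : (Fin 4 → ℂ) → (Fin 4 → ℂ) :=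
  fun z => ![-(starRingEnd ℂ) (z 1), (starRingEnd ℂ) (z 0),
             -(starRingEnd ℂ) (z 3), (starRingEnd ℂ) (z 2)]

/-- A line in `ℙ³(ℂ)`: a 2-dimensional `ℂ`-subspace of `ℂ⁴`. -/
def IsLine (W : Submodule ℂ (Fin 4 → ℂ)) : Prop := Module.finrank ℂ W = 2

/-- A twistor line: a line whose underlying subspace satisfies `j(W) = W`. -/
def IsTwistorLine (W : Submodule ℂ (Fin 4 → ℂ)) : Prop :=
  IsLine W ∧ J '' (W : Set (Fin 4 → ℂ)) = (W : Set (Fin 4 → ℂ))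

/-- A polynomial vanishes identically on a subspace. -/
def VanishesOn (f : MvPolynomial (Fin 4) ℂ) (W : Submodule ℂ (Fin 4 → ℂ)) : Prop :=
  ∀ z ∈ W, eval z f = 0

/-- The surface `{f = 0}` is nonsingular: no nonzero point of `ℂ⁴` is a common zero of
`f` and all its partial derivatives. -/
def Nonsingular (f : MvPolynomial (Fin 4) ℂ) : Prop :=
  ∀ z : Fin 4 → ℂ, z ≠ 0 → eval z f = 0 → ∃ i, eval z (pderiv i f) ≠ 0

/-- The cubic `z₁z₄² + z₂z₃² − z₃z₂² − z₄z₁²`. -/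
def specialCubic : MvPolynomial (Fin 4) ℂ :=
  X 0 * X 3 ^ 2 + X 1 * X 2 ^ 2 - X 2 * X 1 ^ 2 - X 3 * X 0 ^ 2


theorem eval_specialCubic (z : Fin 4 → ℂ) :
    eval z specialCubic =
      z 0 * z 3 ^ 2 + z 1 * z 2 ^ 2 - z 2 * z 1 ^ 2 - z 3 * z 0 ^ 2 := by
  simp [specialCubic]

theorem nonsingular_specialCubic : Nonsingular specialCubic := by
  intro z hz _
  by_contra! h
  have h0 := h 0
  have h1 := h 1
  have h2 := h 2
  have h3 := h 3
  simp [specialCubic, pderiv_X] at h0 h1 h2 h3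
  have a0 : z 0 = 0 := by
    have : z 0 ^ 3 = 0 := by grind
    simpa using this
  have a1 : z 1 = 0 := by
    have : z 1 ^ 3 = 0 := by grind
    simpa using this
  have a2 : z 2 = 0 := by simpa [a1] using h1
  have a3 : z 3 = 0 := by simpa [a0] using h0
  exact hz (by ext i; fin_cases i <;> assumption)

theorem J_J (z : Fin 4 → ℂ) : J (J z) = -z := by
  ext i; fin_cases i <;> simp [J]

theorem J_image_eq {W : Submodule ℂ (Fin 4 → ℂ)} (h : ∀ z ∈ W, J z ∈ W) :
    J '' (W : Set (Fin 4 → ℂ)) = W := by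
  apply Set.Subset.antisymm
  · rintro _ ⟨z, hz, rfl⟩
    exact h z hz
  · intro z hz
    refine ⟨J (-z), h _ (W.neg_mem hz), ?_⟩
    rw [J_J, neg_neg]

theorem IsTwistorLine.J_mem {W : Submodule ℂ (Fin 4 → ℂ)} (hW : IsTwistorLine W)
    {z : Fin 4 → ℂ} (hz : z ∈ W) : J z ∈ W := by
  have h : J z ∈ J '' (W : Set (Fin 4 → ℂ)) := Set.mem_image_of_mem _ hz
  rwa [hW.2] at h

theorem isLine_span_pair {v w : Fin 4 → ℂ} (h : LinearIndependent ℂ ![v, w]) :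
    IsLine (Submodule.span ℂ {v, w}) := by
  have hrank := finrank_span_eq_card h
  rwa [Matrix.range_cons_cons_empty] at hrank

theorem IsLine.eq_of_le {V W : Submodule ℂ (Fin 4 → ℂ)} (hV : IsLine V) (hW : IsLine W)
    (h : V ≤ W) : V = W :=
  Submodule.eq_of_le_of_finrank_eq h (hV.trans hW.symm)

theorem mem_span_last {z : Fin 4 → ℂ} :
    z ∈ Submodule.span ℂ {(![0,0,0,1] : Fin 4 → ℂ), ![0,0,1,0]} ↔ z 0 = 0 ∧ z 1 = 0 := by
  rw [Submodule.mem_span_pair]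
  constructor
  · rintro ⟨a, b, rfl⟩
    simp
  · rintro ⟨h0, h1⟩
    exact ⟨z 3, z 2, by ext i; fin_cases i <;> simp [h0, h1]⟩

theorem mem_span_first {z : Fin 4 → ℂ} :
    z ∈ Submodule.span ℂ {(![0,1,0,0] : Fin 4 → ℂ), ![1,0,0,0]} ↔ z 2 = 0 ∧ z 3 = 0 := by
  rw [Submodule.mem_span_pair]
  constructor
  · rintro ⟨a, b, rfl⟩
    simp
  · rintro ⟨h0, h1⟩
    exact ⟨z 1, z 0, by ext i; fin_cases i <;> simp [h0, h1]⟩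

theorem mem_span_graph {t : ℂ} {z : Fin 4 → ℂ} :
    z ∈ Submodule.span ℂ {(![0,t,0,1] : Fin 4 → ℂ), ![(starRingEnd ℂ) t,0,1,0]} ↔
      z 0 = z 2 * (starRingEnd ℂ) t ∧ z 1 = z 3 * t := by
  rw [Submodule.mem_span_pair]
  constructor
  · rintro ⟨a, b, rfl⟩
    simp
  · rintro ⟨h0, h1⟩
    exact ⟨z 3, z 2, by ext i; fin_cases i <;> simp [h0, h1]⟩

theorem isLine_span_last :
    IsLine (Submodule.span ℂ {(![0,0,0,1] : Fin 4 → ℂ), ![0,0,1,0]}) := by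
  refine isLine_span_pair (LinearIndependent.pair_iff.2 fun a b h => ?_)
  exact ⟨by simpa using congrFun h 3, by simpa using congrFun h 2⟩

theorem isLine_span_first :
    IsLine (Submodule.span ℂ {(![0,1,0,0] : Fin 4 → ℂ), ![1,0,0,0]}) := by
  refine isLine_span_pair (LinearIndependent.pair_iff.2 fun a b h => ?_)
  exact ⟨by simpa using congrFun h 1, by simpa using congrFun h 0⟩

theorem isLine_span_graph (t : ℂ) :
    IsLine (Submodule.span ℂ {(![0,t,0,1] : Fin 4 → ℂ), ![(starRingEnd ℂ) t,0,1,0]}) := by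
  refine isLine_span_pair (LinearIndependent.pair_iff.2 fun a b h => ?_)
  exact ⟨by simpa using congrFun h 3, by simpa using congrFun h 2⟩

theorem isTwistorLine_span_last :
    IsTwistorLine (Submodule.span ℂ {(![0,0,0,1] : Fin 4 → ℂ), ![0,0,1,0]}) := by
  refine ⟨isLine_span_last, J_image_eq fun z hz => ?_⟩
  rw [mem_span_last] at hz ⊢
  simp [J, hz]

theorem isTwistorLine_span_first :
    IsTwistorLine (Submodule.span ℂ {(![0,1,0,0] : Fin 4 → ℂ), ![1,0,0,0]}) := by
  refine ⟨isLine_span_first, J_image_eq fun z hz => ?_⟩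
  rw [mem_span_first] at hz ⊢
  simp [J, hz]

theorem isTwistorLine_span_graph (t : ℂ) :
    IsTwistorLine
      (Submodule.span ℂ {(![0,t,0,1] : Fin 4 → ℂ), ![(starRingEnd ℂ) t,0,1,0]}) := by
  refine ⟨isLine_span_graph t, J_image_eq fun z hz => ?_⟩
  rw [mem_span_graph] at hz ⊢
  simp [J, hz]

theorem conj_eq_sq_of_pow_three_eq_one {t : ℂ} (ht : t ^ 3 = 1) :
    (starRingEnd ℂ) t = t ^ 2 := by
  have h : (starRingEnd ℂ) t * t = 1 := by
    rw [mul_comm, Complex.mul_conj, Complex.normSq_eq_norm_sq,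
      Complex.norm_eq_one_of_pow_eq_one ht (by norm_num)]
    simp
  grind

theorem vanishesOn_span_graph {t : ℂ} (ht : t ^ 3 = 1) :
    VanishesOn specialCubic
      (Submodule.span ℂ {(![0,t,0,1] : Fin 4 → ℂ), ![(starRingEnd ℂ) t,0,1,0]}) := by
  intro z hz
  rw [mem_span_graph, conj_eq_sq_of_pow_three_eq_one ht] at hz
  rw [eval_specialCubic, hz.1, hz.2]
  linear_combination (-z 2 ^ 2 * z 3 * t) * ht

theorem normSq_add_normSq_ne_zero {a b : ℂ} (h : a ≠ 0 ∨ b ≠ 0) :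
    a * (starRingEnd ℂ) a + b * (starRingEnd ℂ) b ≠ 0 := by
  rw [Complex.mul_conj, Complex.mul_conj]
  norm_cast
  rcases h with h | h
  · have := Complex.normSq_pos.2 h
    have := Complex.normSq_nonneg b
    positivity
  · have := Complex.normSq_pos.2 h
    have := Complex.normSq_nonneg a
    positivity

/-- A twistor line meeting the line `z₁ = z₂ = 0` is equal to it. -/
theorem IsTwistorLine.eq_span_last {W : Submodule ℂ (Fin 4 → ℂ)} (hW : IsTwistorLine W)
    {v : Fin 4 → ℂ} (hv : v ∈ W) (hv0 : v ≠ 0) (h0 : v 0 = 0) (h1 : v 1 = 0) :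
    W = Submodule.span ℂ {(![0,0,0,1] : Fin 4 → ℂ), ![0,0,1,0]} := by
  have hne : v 2 ≠ 0 ∨ v 3 ≠ 0 := by
    by_contra! h
    exact hv0 (by ext i; fin_cases i <;> simp [h0, h1, h])
  have hN := normSq_add_normSq_ne_zero hne
  have hmem : (![0,0,1,0] : Fin 4 → ℂ) ∈ W := by
    rw [← W.smul_mem_iff hN]
    convert W.sub_mem (W.smul_mem ((starRingEnd ℂ) (v 2)) hv)
      (W.smul_mem (v 3) (hW.J_mem hv)) using 1
    ext i; fin_cases i <;> simp [J, h0, h1] <;> ring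
  have hmem' : (![0,0,0,1] : Fin 4 → ℂ) ∈ W := by
    simpa [J] using hW.J_mem hmem
  refine (isLine_span_last.eq_of_le hW.1 ?_).symm
  simp [Submodule.span_le, Set.insert_subset_iff, hmem, hmem']

/-- A twistor line meeting the line `z₃ = z₄ = 0` is equal to it. -/
theorem IsTwistorLine.eq_span_first {W : Submodule ℂ (Fin 4 → ℂ)} (hW : IsTwistorLine W)
    {v : Fin 4 → ℂ} (hv : v ∈ W) (hv0 : v ≠ 0) (h2 : v 2 = 0) (h3 : v 3 = 0) :
    W = Submodule.span ℂ {(![0,1,0,0] : Fin 4 → ℂ), ![1,0,0,0]} := by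
  have hne : v 0 ≠ 0 ∨ v 1 ≠ 0 := by
    by_contra! h
    exact hv0 (by ext i; fin_cases i <;> simp [h2, h3, h])
  have hN := normSq_add_normSq_ne_zero hne
  have hmem : (![1,0,0,0] : Fin 4 → ℂ) ∈ W := by
    rw [← W.smul_mem_iff hN]
    convert W.sub_mem (W.smul_mem ((starRingEnd ℂ) (v 0)) hv)
      (W.smul_mem (v 1) (hW.J_mem hv)) using 1
    ext i; fin_cases i <;> simp [J, h2, h3] <;> ring
  have hmem' : (![0,1,0,0] : Fin 4 → ℂ) ∈ W := by
    simpa [J] using hW.J_mem hmem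
  refine (isLine_span_first.eq_of_le hW.1 ?_).symm
  simp [Submodule.span_le, Set.insert_subset_iff, hmem, hmem']

/-- A line disjoint from `z₃ = z₄ = 0` projects onto the last two coordinates. -/
theorem IsLine.exists_mem_last_eq {W : Submodule ℂ (Fin 4 → ℂ)} (hW : IsLine W)
    (h : ∀ v ∈ W, v 2 = 0 → v 3 = 0 → v = 0) (c d : ℂ) :
    ∃ v ∈ W, v 2 = c ∧ v 3 = d := by
  let π : W →ₗ[ℂ] ℂ × ℂ :=
    ((LinearMap.proj 2).prod (LinearMap.proj 3) : (Fin 4 → ℂ) →ₗ[ℂ] ℂ × ℂ).comp W.subtype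
  have hinj : Function.Injective π := by
    rw [← LinearMap.ker_eq_bot, LinearMap.ker_eq_bot']
    rintro ⟨v, hv⟩ hπ
    have hπ' : v 2 = 0 ∧ v 3 = 0 := by simpa [π] using hπ
    exact Subtype.ext (h v hv hπ'.1 hπ'.2)
  have hsurj : Function.Surjective π := by
    refine (LinearMap.injective_iff_surjective_of_finrank_eq_finrank ?_).1 hinj
    rw [show Module.finrank ℂ W = 2 from hW]
    simp
  obtain ⟨⟨v, hv⟩, hπ⟩ := hsurj (c, d)
  exact ⟨v, hv, by simpa [π] using hπ⟩

/-- The conditions for the twistor line through `(p, q, 0, 1)` to lie on the cubic. -/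
theorem coefficients_of_vanishing {p q p' q' : ℂ}
    (h : ∀ u : ℂ, (p + u * q') + (q - u * p') * u ^ 2 - u * (q - u * p') ^ 2
      - (p + u * q') ^ 2 = 0) :
    p = p ^ 2 ∧ q' = q ^ 2 + 2 * p * q' ∧ q + 2 * q * p' = q' ^ 2 ∧ p' = - p' ^ 2 := by
  have h0 := h 0
  have h1 := h 1
  have h2 := h (-1)
  have h3 := h 2
  refine ⟨?_, ?_, ?_, ?_⟩ <;> grind

theorem IsTwistorLine.eq_of_vanishesOn {W : Submodule ℂ (Fin 4 → ℂ)}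
    (hW : IsTwistorLine W) (hf : VanishesOn specialCubic W) :
    W = Submodule.span ℂ {(![0,0,0,1] : Fin 4 → ℂ), ![0,0,1,0]} ∨
    W = Submodule.span ℂ {(![0,1,0,0] : Fin 4 → ℂ), ![1,0,0,0]} ∨
    ∃ t : ℂ, t ^ 3 = 1 ∧
      W = Submodule.span ℂ {(![0,t,0,1] : Fin 4 → ℂ), ![(starRingEnd ℂ) t,0,1,0]} := by
  by_cases hfirst : ∀ v ∈ W, v 2 = 0 → v 3 = 0 → v = 0
  swap
  · push Not at hfirst
    obtain ⟨v, hv, h2, h3, hv0⟩ := hfirst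
    exact Or.inr (Or.inl (hW.eq_span_first hv hv0 h2 h3))
  obtain ⟨v, hv, h2, h3⟩ := hW.1.exists_mem_last_eq hfirst 0 1
  have hJv := hW.J_mem hv
  have hpoly (u : ℂ) := hf _ (W.sub_mem hv (W.smul_mem u hJv))
  simp only [eval_specialCubic] at hpoly
  simp [J, h2, h3] at hpoly
  obtain ⟨e1, e2, e3, e4⟩ := coefficients_of_vanishing (p := v 0) (q := v 1)
    (p' := (starRingEnd ℂ) (v 0)) (q' := (starRingEnd ℂ) (v 1))
    (fun u => by linear_combination hpoly u)
  have e4' : v 0 = -v 0 ^ 2 := by simpa using congrArg (starRingEnd ℂ) e4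
  have hp : v 0 = 0 := by linear_combination (e1 + e4') / 2
  simp only [hp, map_zero] at e2 e3
  by_cases hq : v 1 = 0
  · exact Or.inl (hW.eq_span_last hv (fun h => by simp [h] at h3) hp hq)
  refine Or.inr (Or.inr ⟨v 1, mul_left_cancel₀ hq ?_, ?_⟩)
  · grind
  · refine ((isLine_span_graph _).eq_of_le hW.1 ?_).symm
    have hmem : ![0, v 1, 0, 1] ∈ W := by
      convert hv using 1
      ext i; fin_cases i <;> simp [hp, h2, h3]
    have hmem' : ![(starRingEnd ℂ) (v 1), 0, 1, 0] ∈ W := by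
      convert W.neg_mem hJv using 1
      ext i; fin_cases i <;> simp [J, hp, h2, h3]
    simp [Submodule.span_le, Set.insert_subset_iff, hmem, hmem']

theorem span_graph_injective : Function.Injective fun t : ℂ =>
    Submodule.span ℂ {(![0,t,0,1] : Fin 4 → ℂ), ![(starRingEnd ℂ) t,0,1,0]} := by
  intro s t h
  have hs : (![0,s,0,1] : Fin 4 → ℂ) ∈
      Submodule.span ℂ {(![0,s,0,1] : Fin 4 → ℂ), ![(starRingEnd ℂ) s,0,1,0]} :=
    Submodule.subset_span (by simp)
  have ht := (SetLike.ext_iff.1 h _).1 hs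
  simpa using (mem_span_graph.1 ht).2

theorem encard_cube_roots_of_unity : {t : ℂ | t ^ 3 = 1}.encard = 3 := by
  have h : {t : ℂ | t ^ 3 = 1} = (Polynomial.nthRootsFinset 3 (1 : ℂ) : Set ℂ) := by
    ext t
    simp
  rw [h, Set.encard_coe_eq_coe_finsetCard,
    (Complex.isPrimitiveRoot_exp 3 (by norm_num)).card_nthRootsFinset]
  rfl

theorem setOf_twistorLines_eq :
    {W : Submodule ℂ (Fin 4 → ℂ) | IsTwistorLine W ∧ VanishesOn specialCubic W} =
      ({Submodule.span ℂ {(![0,0,0,1] : Fin 4 → ℂ), ![0,0,1,0]},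
        Submodule.span ℂ {(![0,1,0,0] : Fin 4 → ℂ), ![1,0,0,0]}} ∪
       {W | ∃ t : ℂ, t ^ 3 = 1 ∧
          W = Submodule.span ℂ {(![0,t,0,1] : Fin 4 → ℂ), ![(starRingEnd ℂ) t,0,1,0]}}) := by
  ext W
  constructor
  · rintro ⟨hW, hf⟩
    rcases hW.eq_of_vanishesOn hf with h | h | h
    · exact Or.inl (Or.inl h)
    · exact Or.inl (Or.inr h)
    · exact Or.inr h
  · rintro ((rfl | rfl) | ⟨t, ht, rfl⟩)
    · refine ⟨isTwistorLine_span_last, fun z hz => ?_⟩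
      rw [mem_span_last] at hz
      simp [eval_specialCubic, hz]
    · refine ⟨isTwistorLine_span_first, fun z hz => ?_⟩
      rw [mem_span_first] at hz
      simp [eval_specialCubic, hz]
    · exact ⟨isTwistorLine_span_graph t, vanishesOn_span_graph ht⟩

theorem encard_twistorLines :
    ({Submodule.span ℂ {(![0,0,0,1] : Fin 4 → ℂ), ![0,0,1,0]},
        Submodule.span ℂ {(![0,1,0,0] : Fin 4 → ℂ), ![1,0,0,0]}} ∪
       {W | ∃ t : ℂ, t ^ 3 = 1 ∧
          W = Submodule.span ℂ
            {(![0,t,0,1] : Fin 4 → ℂ), ![(starRingEnd ℂ) t,0,1,0]}}).encard = 5 := by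
  have himage : {W | ∃ t : ℂ, t ^ 3 = 1 ∧ W = Submodule.span ℂ
        {(![0,t,0,1] : Fin 4 → ℂ), ![(starRingEnd ℂ) t,0,1,0]}} =
      (fun t : ℂ => Submodule.span ℂ
        {(![0,t,0,1] : Fin 4 → ℂ), ![(starRingEnd ℂ) t,0,1,0]}) '' {t | t ^ 3 = 1} := by
    ext W
    simp [eq_comm]
  have hmem (t : ℂ) : (![0,t,0,1] : Fin 4 → ℂ) ∈
      Submodule.span ℂ {(![0,t,0,1] : Fin 4 → ℂ), ![(starRingEnd ℂ) t,0,1,0]} :=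
    Submodule.subset_span (by simp)
  rw [Set.encard_union_eq, Set.encard_pair, himage, span_graph_injective.encard_image,
    encard_cube_roots_of_unity]
  · norm_num
  · intro h
    have hw : (![0,0,0,1] : Fin 4 → ℂ) ∈
        Submodule.span ℂ {(![0,0,0,1] : Fin 4 → ℂ), ![0,0,1,0]} :=
      Submodule.subset_span (by simp)
    rw [h, mem_span_first] at hw
    simp at hw
  · rw [Set.disjoint_left]
    rintro W (rfl | rfl) ⟨t, ht, h⟩
    · have hw := h ▸ hmem t
      rw [mem_span_last] at hw
      have ht0 : t = 0 := by simpa using hw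
      simp [ht0] at ht
    · have hw := h ▸ hmem t
      rw [mem_span_first] at hw
      simp at hw

/-- The surface `z₁z₄² + z₂z₃² − z₃z₂² − z₄z₁² = 0` is nonsingular and contains exactly
five twistor lines: `span{(0,0,0,1),(0,0,1,0)}`, `span{(0,1,0,0),(1,0,0,0)}`, and
`span{(0,t,0,1),(t̄,0,1,0)}` for `t` a cube root of unity. -/
theorem specialCubic_five_twistor_lines :
    Nonsingular specialCubic ∧
    {W : Submodule ℂ (Fin 4 → ℂ) | IsTwistorLine W ∧ VanishesOn specialCubic W} =
      ({Submodule.span ℂ {(![0,0,0,1] : Fin 4 → ℂ), ![0,0,1,0]},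
        Submodule.span ℂ {(![0,1,0,0] : Fin 4 → ℂ), ![1,0,0,0]}} ∪
       {W | ∃ t : ℂ, t ^ 3 = 1 ∧
          W = Submodule.span ℂ {(![0,t,0,1] : Fin 4 → ℂ), ![(starRingEnd ℂ) t,0,1,0]}}) ∧
    {W : Submodule ℂ (Fin 4 → ℂ) | IsTwistorLine W ∧ VanishesOn specialCubic W}.encard = 5 :=
  ⟨nonsingular_specialCubic, setOf_twistorLines_eq,
    setOf_twistorLines_eq ▸ encard_twistorLines⟩
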